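/- arXiv:2204.13764 — 2 statements merged into one kernel-verified Lean document; each statement's English description precedes it below -/
import Mathlib

section
/- Let K be a field and let A be a finite-dimensional associative unital K-algebra of finite global dimension (i.e., there exists an integer m such that every right A-module has projective dimension at most m), and let J be the Jacobson radical of A regarded as a right A-module. Then Ext_A^1(J, J) = 0 if and only if every right A-module has projective dimension at most 1 (i.e., A is hereditary). -/
open CategoryTheory CategoryTheory.Limits Opposite

noncomputable section

/-- A module `M` has projective dimension at most `m` if it admits a projective resolution
of length at most `m`, i.e. a projective resolution whose terms vanish in degrees `> m`. -/
def ProjDimLE {C : Type*} [Category C] [Abelian C] (M : C) (m : ℕ) : Prop :=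
  ∃ P : ProjectiveResolution M, ∀ i : ℕ, m < i → IsZero (P.complex.X i)

/-- Vanishing of `Ext^1(X, Y)` gives lifting of maps from `X` along epimorphisms with kernel `Y`. -/
lemma exists_lift_of_ext {K : Type} [Field K] {C : Type*} [Category C] [Abelian C]
    [Linear K C] [EnoughProjectives C] {X : C} (S : ShortComplex C) (hS : S.ShortExact)
    (h : IsZero (((Ext K C 1).obj (op X)).obj S.X₁)) (f : X ⟶ S.X₃) :
    ∃ g : X ⟶ S.X₂, g ≫ S.g = f := by
  have := hS.mono_f
  have := hS.epi_g
  let P := ProjectiveResolution.of X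
  have h1 : IsZero ((P.complex.linearYonedaObj K S.X₁).homology 1) :=
    IsZero.of_iso h (P.isoExt (R := K) 1 S.X₁).symm
  rw [← HomologicalComplex.exactAt_iff_isZero_homology,
    HomologicalComplex.exactAt_iff' _ 0 1 2 (by simp) (by simp),
    ShortComplex.moduleCat_exact_iff] at h1
  let f' : ((ChainComplex.single₀ C).obj X).X 0 ⟶ S.X₃ := f
  let l : P.complex.X 0 ⟶ S.X₂ := Projective.factorThru (P.π.f 0 ≫ f') S.g
  have hl : l ≫ S.g = P.π.f 0 ≫ f' := Projective.factorThru_comp _ _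
  have hz : (P.complex.d 1 0 ≫ l) ≫ S.g = 0 := by
    rw [Category.assoc, hl, ← Category.assoc, P.complex_d_comp_π_f_zero, zero_comp]
  let c : P.complex.X 1 ⟶ S.X₁ := hS.exact.lift _ hz
  have hc : c ≫ S.f = P.complex.d 1 0 ≫ l := hS.exact.lift_f _ hz
  have hcc : P.complex.d 2 1 ≫ c = 0 := by
    rw [← cancel_mono S.f, Category.assoc, hc]
    simp
  obtain ⟨e, he⟩ := h1 c hcc
  change P.complex.X 0 ⟶ S.X₁ at e
  change P.complex.d 1 0 ≫ e = c at he
  have hd : P.complex.d 1 0 ≫ (l - e ≫ S.f) = 0 := by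
    rw [Preadditive.comp_sub, ← Category.assoc, he, hc, sub_self]
  have hepi : Epi (P.π.f 0) := inferInstance
  let w : ((ChainComplex.single₀ C).obj X).X 0 ⟶ S.X₂ := P.exact₀.desc _ hd
  have hw : P.π.f 0 ≫ w = l - e ≫ S.f := P.exact₀.g_desc _ hd
  suffices hh : w ≫ S.g = f' from ⟨w, hh⟩
  rw [← cancel_epi (P.π.f 0), ← Category.assoc, hw]
  rw [Preadditive.sub_comp, hl, Category.assoc, S.zero, comp_zero, sub_zero]

lemma hasPD_of_projDimLE_one {C : Type*} [Category C] [Abelian C] {M : C}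
    (h : ProjDimLE M 1) : HasProjectiveDimensionLT M 2 := by
  obtain ⟨P, hP⟩ := h
  have hm : Mono (P.complex.d 1 0) := (P.exact_succ 0).mono_g
    ((hP 2 (by norm_num)).eq_of_src _ _)
  have hepi : Epi (P.π.f 0) := inferInstance
  have hS : (ShortComplex.mk _ _ P.complex_d_comp_π_f_zero).ShortExact :=
    { exact := P.exact₀, mono_f := hm, epi_g := hepi }
  refine hS.hasProjectiveDimensionLT_X₃ 1 ?_ ?_
  · exact (inferInstance : HasProjectiveDimensionLT (P.complex.X 1) 1)
  · exact (inferInstance : HasProjectiveDimensionLT (P.complex.X 0) 2)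

section Res
variable {C : Type*} [Category C] [Abelian C]
open ZeroObject

/-- The two-term complex. -/
def twoTerm (S : ShortComplex C) : ChainComplex C ℕ :=
  ChainComplex.mk' S.X₂ S.X₁ S.f (fun _ => ⟨0, 0, by simp⟩)

lemma twoTerm_isZero (S : ShortComplex C) (n : ℕ) : IsZero ((twoTerm S).X (n + 2)) := by
  obtain _ | n := n <;> exact isZero_zero C

lemma twoTerm_d (S : ShortComplex C) : (twoTerm S).d 1 0 = S.f := by
  simp [twoTerm]

lemma projDimLE_one_of_hasPD [EnoughProjectives C] {M : C}
    (h : HasProjectiveDimensionLT M 2) : ProjDimLE M 1 := by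
  let S : ShortComplex C := ShortComplex.mk (kernel.ι (Projective.π M)) (Projective.π M)
    (kernel.condition _)
  have hS : S.ShortExact := { exact := ShortComplex.exact_kernel _ }
  have := hS.mono_f
  have := hS.epi_g
  have h2 : Projective S.X₂ := Projective.projective_over M
  have h1' : HasProjectiveDimensionLT S.X₁ 1 :=
    hS.hasProjectiveDimensionLT_X₁ 1 inferInstance h
  have h1 : Projective S.X₁ := inferInstance
  have hmono : Mono ((twoTerm S).d 1 0) := by rw [twoTerm_d]; exact hS.mono_f
  refine ⟨{ complex := twoTerm S
            projective := ?_
            π := (ChainComplex.toSingle₀Equiv _ _).symm ⟨S.g, by rw [twoTerm_d]; exact S.zero⟩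
            quasiIso := ⟨fun n => ?_⟩ }, ?_⟩
  · rintro (_ | _ | n)
    · exact h2
    · exact h1
    · have := (twoTerm_isZero S n)
      exact this.projective
  · cases n with
    | zero =>
      rw [ChainComplex.quasiIsoAt₀_iff, ShortComplex.quasiIso_iff_of_zeros']
      · refine (ShortComplex.exact_and_epi_g_iff_of_iso ?_).2 ⟨hS.exact, hS.epi_g⟩
        exact ShortComplex.isoMk (Iso.refl _) (Iso.refl _) (Iso.refl _)
          (by
            change 𝟙 _ ≫ S.f = (twoTerm S).d 1 0 ≫ 𝟙 _
            rw [twoTerm_d]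
            exact (Category.id_comp _).trans (Category.comp_id _).symm)
          (by
            refine (Category.id_comp _).trans (Eq.trans ?_ (Category.comp_id _).symm)
            exact (ChainComplex.toSingle₀Equiv_symm_apply_f_zero (C := twoTerm S) S.g
              (by rw [twoTerm_d]; exact S.zero)).symm)
      all_goals rfl
    | succ n =>
      rw [quasiIsoAt_iff_exactAt']
      · rw [HomologicalComplex.exactAt_iff' _ (n + 2) (n + 1) n (by simp) (by simp)]
        obtain _ | n := n
        · have hz : ((twoTerm S).sc' (0 + 2) (0 + 1) 0).f = 0 :=
            (twoTerm_isZero S 0).eq_of_src _ _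
          rw [ShortComplex.exact_iff_mono _ hz]
          exact hmono
        · exact ShortComplex.exact_of_isZero_X₂ _ (twoTerm_isZero S n)
      · apply ChainComplex.exactAt_succ_single_obj
  · intro i hi
    obtain ⟨k, rfl⟩ := Nat.exists_eq_add_of_le hi
    rw [show 1 + 1 + k = k + 2 by omega]
    exact twoTerm_isZero S k

end Res

section Mod
universe v
variable {R : Type} [Ring R]

/-- short complex of a submodule -/
abbrev subSC {M : Type v} [AddCommGroup M] [Module R M] (N : Submodule R M) :
    ShortComplex (ModuleCat.{v} R) :=
  ShortComplex.mk (ModuleCat.ofHom N.subtype) (ModuleCat.ofHom N.mkQ) (by ext x; simp)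

lemma subSC_shortExact {M : Type v} [AddCommGroup M] [Module R M] (N : Submodule R M) :
    (subSC N).ShortExact where
  exact := by
    rw [ShortComplex.moduleCat_exact_iff]
    intro x hx
    exact ⟨⟨x, by simpa using hx⟩, rfl⟩
  mono_f := by
    rw [ModuleCat.mono_iff_injective]; exact N.injective_subtype
  epi_g := by
    rw [ModuleCat.epi_iff_surjective]; exact N.mkQ_surjective

lemma semisimple_quot [IsArtinianRing R] : IsSemisimpleModule R (R ⧸ Ring.jacobson R) := by
  have h : Module.IsTorsionBySet R (R ⧸ Ring.jacobson R) (Ring.jacobson R : Set R) := by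
    rw [Module.isTorsionBySet_quotient_iff]
    intro x r hr
    exact Ideal.mul_mem_right _ _ hr
  let _ := h.module
  exact (h.semilinearMap.isSemisimpleModule_iff_of_bijective Function.bijective_id).2
      inferInstance

/-- Lifting along `R → R/J` makes `J` projective. -/
lemma projective_of_lift [IsArtinianRing R]
    (h : ∀ f : Ring.jacobson R →ₗ[R] (R ⧸ Ring.jacobson R),
      ∃ g : Ring.jacobson R →ₗ[R] R, (Ring.jacobson R).mkQ ∘ₗ g = f) :
    Module.Projective R (Ring.jacobson R) := by
  set J := Ring.jacobson R with hJ
  have := semisimple_quot (R := R)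
  obtain ⟨n, g, hg⟩ := Module.Finite.exists_fin' R J
  let N : Submodule R J := J • ⊤
  let π : (Fin n → R) →ₗ[R] (Fin n → R ⧸ J) := LinearMap.pi fun i => J.mkQ ∘ₗ LinearMap.proj i
  have hπ : Function.Surjective π := by
    intro y
    choose x hx using fun i => J.mkQ_surjective (y i)
    exact ⟨x, funext hx⟩
  have hker : LinearMap.ker π ≤ LinearMap.ker (N.mkQ ∘ₗ g) := by
    intro x hx
    have hx' : ∀ i, x i ∈ J := by
      intro i
      have := congrFun (LinearMap.mem_ker.1 hx) i
      exact (Submodule.Quotient.mk_eq_zero J).1 this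
    simp only [LinearMap.mem_ker, LinearMap.comp_apply, Submodule.mkQ_apply,
      Submodule.Quotient.mk_eq_zero]
    rw [pi_eq_sum_univ' x, map_sum]
    refine Submodule.sum_mem _ fun i _ => ?_
    rw [map_smul]
    exact Submodule.smul_mem_smul (hx' i) trivial
  let r : (Fin n → R ⧸ J) →ₗ[R] (J ⧸ N) :=
    (LinearMap.ker π).liftQ (N.mkQ ∘ₗ g) hker ∘ₗ
      (π.quotKerEquivOfSurjective hπ).symm.toLinearMap
  have hr : ∀ x, r (π x) = N.mkQ (g x) := by
    intro x
    have : (π.quotKerEquivOfSurjective hπ).symm (π x) = (LinearMap.ker π).mkQ x := by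
      rw [LinearEquiv.symm_apply_eq]; rfl
    simp only [r, LinearMap.comp_apply, LinearEquiv.coe_coe, this]
    rfl
  have hrs : Function.Surjective r := by
    intro y
    obtain ⟨j, rfl⟩ := N.mkQ_surjective y
    obtain ⟨x, rfl⟩ := hg j
    exact ⟨π x, hr x⟩
  obtain ⟨s, hs⟩ := IsSemisimpleModule.lifting_property r hrs (LinearMap.id)
  choose k hk using fun i => h (LinearMap.proj i ∘ₗ s ∘ₗ N.mkQ)
  let k' : J →ₗ[R] (Fin n → R) := LinearMap.pi k
  have hk' : ∀ x, π (k' x) = s (N.mkQ x) := by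
    intro x
    funext i
    exact LinearMap.congr_fun (hk i) x
  have hid : ∀ x, N.mkQ (g (k' x)) = N.mkQ x := by
    intro x
    rw [← hr, hk']
    exact LinearMap.congr_fun hs _
  let e : J →ₗ[R] J := g ∘ₗ k'
  have hsurj : Function.Surjective e := by
    rw [← LinearMap.range_eq_top]
    have hle : (⊤ : Submodule R (J ⧸ LinearMap.range e)) ≤ Ring.jacobson R • ⊤ := by
      rintro y -
      obtain ⟨x, rfl⟩ := (LinearMap.range e).mkQ_surjective y
      have h1 : x - e x ∈ N := by
        rw [← Submodule.Quotient.mk_eq_zero, Submodule.Quotient.mk_sub, sub_eq_zero]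
        exact (hid x).symm
      have h2 : (LinearMap.range e).mkQ x = (LinearMap.range e).mkQ (x - e x) := by
        rw [map_sub, eq_comm, sub_eq_self]
        simp
      rw [h2]
      have h3 := Submodule.mem_map_of_mem (f := (LinearMap.range e).mkQ) h1
      rw [Submodule.map_smul''] at h3
      exact Submodule.smul_mono le_rfl le_top h3
    have := Submodule.FG.eq_bot_of_le_jacobson_smul Module.Finite.fg_top hle
    rw [eq_top_iff]
    rintro x -
    have h4 : (LinearMap.range e).mkQ x ∈ (⊥ : Submodule R (J ⧸ LinearMap.range e)) := by
      rw [← this]; trivial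
    simpa using h4
  have hinj : Function.Injective e := IsNoetherian.injective_of_surjective_endomorphism e hsurj
  let E := LinearEquiv.ofBijective e ⟨hinj, hsurj⟩
  refine Module.Projective.of_split (k' ∘ₗ E.symm.toLinearMap) g ?_
  ext1 x
  exact E.apply_symm_apply x

lemma hasPD_finsupp (h : Module.Projective R (Ring.jacobson R)) (ι : Type v) :
    HasProjectiveDimensionLT (ModuleCat.of R (ι →₀ (R ⧸ Ring.jacobson R))) 2 := by
  let J := Ring.jacobson R
  let S : ShortComplex (ModuleCat.{v} R) := ShortComplex.mk
    (ModuleCat.ofHom (Finsupp.mapRange.linearMap (α := ι) J.subtype))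
    (ModuleCat.ofHom (Finsupp.mapRange.linearMap (α := ι) J.mkQ)) (by
      rw [← ModuleCat.ofHom_comp, ← Finsupp.mapRange.linearMap_comp]
      have : J.mkQ ∘ₗ J.subtype = 0 := by
        ext x
        exact (Submodule.Quotient.mk_eq_zero J).2 x.2
      rw [this]
      ext; simp)
  have hS : S.ShortExact :=
    { exact := by
        rw [ShortComplex.moduleCat_exact_iff]
        intro x hx
        change ι →₀ R at x
        change Finsupp.mapRange.linearMap J.mkQ x = 0 at hx
        have hx' : ∀ i, x i ∈ J := by
          intro i
          have := DFunLike.congr_fun hx i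
          exact (Submodule.Quotient.mk_eq_zero J).1 this
        let y : ι →₀ J := Finsupp.onFinset x.support (fun i => ⟨x i, hx' i⟩) (by
          intro a ha
          simpa [Subtype.ext_iff] using ha)
        refine ⟨y, ?_⟩
        change Finsupp.mapRange.linearMap J.subtype y = x
        ext i
        simp [y]
      mono_f := by
        rw [ModuleCat.mono_iff_injective]
        exact Finsupp.mapRange_injective _ (map_zero _) J.injective_subtype
      epi_g := by
        rw [ModuleCat.epi_iff_surjective]
        exact Finsupp.mapRange_surjective _ (map_zero _) J.mkQ_surjective }
  have : Module.Projective R J := h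
  have : Module.Projective R (ι →₀ J) := by
    classical
    exact Module.Projective.of_equiv (finsuppLequivDFinsupp R (ι := ι) (M := J)).symm
  have p1 : Projective S.X₁ :=
    (IsProjective.iff_projective (R := R) (ι →₀ J)).1 inferInstance
  have p2 : Projective S.X₂ :=
    (IsProjective.iff_projective (R := R) (ι →₀ R)).1 inferInstance
  exact hS.hasProjectiveDimensionLT_X₃ 1 inferInstance inferInstance

lemma hasPD_of_projective [IsArtinianRing R] (h : Module.Projective R (Ring.jacobson R))
    (M : Type v) [AddCommGroup M] [Module R M] :
    HasProjectiveDimensionLT (ModuleCat.of R M) 2 := by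
  refine IsSemiprimaryRing.induction R R M
    (P := fun M _ _ _ => HasProjectiveDimensionLT (ModuleCat.of R M) 2)
    (fun M _ _ m _ _ ht => ?_) ?_
  · have := semisimple_quot (R := R)
    let r : (M →₀ (R ⧸ Ring.jacobson R)) →ₗ[R] M := Finsupp.lsum ℕ fun m =>
      (Ring.jacobson R).liftQ (LinearMap.toSpanSingleton R M m) (by
        intro a ha
        exact ht (a := ⟨a, ha⟩) (x := m))
    have hr : Function.Surjective r := by
      intro m
      refine ⟨Finsupp.single m ((Ring.jacobson R).mkQ 1), ?_⟩
      simp only [r, Finsupp.lsum_single]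
      exact one_smul R m
    obtain ⟨s, hs⟩ := IsSemisimpleModule.lifting_property r hr LinearMap.id
    have := hasPD_finsupp h M
    let ret : Retract (ModuleCat.of R M) (ModuleCat.of R (M →₀ (R ⧸ Ring.jacobson R))) :=
      { i := ModuleCat.ofHom s
        r := ModuleCat.ofHom r
        retract := by rw [← ModuleCat.ofHom_comp, hs]; rfl }
    exact ret.hasProjectiveDimensionLT 2
  · intro M _ _ _ _ N h1 h2
    exact (subSC_shortExact N).hasProjectiveDimensionLT_X₂ 2 h1 h2

end Mod

lemma main_aux.{v} (K : Type) [Field K] (R : Type) [Ring R] [Algebra K R] [IsArtinianRing R]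
    (J : Ideal R) (hJ : J = Ring.jacobson R) :
    IsZero (((Ext K (ModuleCat R) 1).obj (op (ModuleCat.of R J))).obj (ModuleCat.of R J)) ↔
      ∀ M : ModuleCat.{v} R, ProjDimLE M 1 := by
  subst hJ
  constructor
  · intro h M
    apply projDimLE_one_of_hasPD
    refine hasPD_of_projective (projective_of_lift fun f => ?_) M
    obtain ⟨g, hg⟩ := exists_lift_of_ext (subSC (Ring.jacobson R)) (subSC_shortExact _) h
      (ModuleCat.ofHom f)
    exact ⟨g.hom, congrArg ModuleCat.Hom.hom hg⟩
  · intro h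
    let E : ULift.{v} R ≃ₗ[R] R := ULift.moduleEquiv
    let N : Submodule R (ULift.{v} R) := Submodule.map E.symm.toLinearMap (Ring.jacobson R)
    have p0 : Module.Projective R (ULift.{v} R) := Module.Projective.of_equiv E.symm
    have p2 : Projective (ModuleCat.of R (ULift.{v} R)) :=
      (IsProjective.iff_projective (R := R) (ULift.{v} R)).1 p0
    have h1 : HasProjectiveDimensionLT (ModuleCat.of R N) 1 :=
      (subSC_shortExact N).hasProjectiveDimensionLT_X₁ 1
        (inferInstance : HasProjectiveDimensionLT (ModuleCat.of R (ULift.{v} R)) 1)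
        (hasPD_of_projDimLE_one (h _))
    have p3 : Projective (ModuleCat.of R N) := inferInstance
    have p4 : Module.Projective R N := (IsProjective.iff_projective (R := R) N).2 p3
    have p5 : Module.Projective R (Ring.jacobson R) :=
      Module.Projective.of_equiv (E.symm.submoduleMap (Ring.jacobson R)).symm
    have p6 : Projective (ModuleCat.of R (Ring.jacobson R)) :=
      (IsProjective.iff_projective (R := R) _).1 p5
    exact isZero_Ext_succ_of_projective _ _ 0

/-- Let `K` be a field and `A` a finite-dimensional associative unital `K`-algebra of finite
global dimension (there is an `m` such that every right `A`-module has projective dimension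
at most `m`), and let `J` be the Jacobson radical of `A` regarded as a right `A`-module (the
intersection of all maximal right ideals of `A`, i.e. the Jacobson radical of the ring
`Aᵐᵒᵖ`).  Then `Ext_A^1(J, J) = 0` if and only if every right `A`-module has projective
dimension at most `1` (i.e. `A` is hereditary).  Right `A`-modules are modules over `Aᵐᵒᵖ`,
and `Ext` is taken in the category `ModuleCat Aᵐᵒᵖ`. -/
theorem stmt7 (K : Type) [Field K] (A : Type) [Ring A] [Algebra K A]
    [FiniteDimensional K A]
    (hgldim : ∃ m : ℕ, ∀ M : ModuleCat Aᵐᵒᵖ, ProjDimLE M m) :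
    IsZero (((Ext K (ModuleCat Aᵐᵒᵖ) 1).obj
          (op (ModuleCat.of Aᵐᵒᵖ (Ideal.jacobson (⊥ : Ideal Aᵐᵒᵖ))))).obj
        (ModuleCat.of Aᵐᵒᵖ (Ideal.jacobson (⊥ : Ideal Aᵐᵒᵖ)))) ↔
      ∀ M : ModuleCat Aᵐᵒᵖ, ProjDimLE M 1 := by
  have : IsArtinianRing Aᵐᵒᵖ := IsArtinianRing.of_finite K Aᵐᵒᵖ
  exact main_aux K Aᵐᵒᵖ _ Ideal.jacobson_bot
end
end

section
/- For every n ≥ 0, the number of 321-avoiding permutations π of {1,…,n+1} such that for every index i with 1 ≤ i ≤ n the permutation π does NOT map {1,…,i} onto itself equals the n-th Catalan number C_n. -/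
/-- A permutation `π` of `{1,…,m}` (modeled as `Fin m`, where the 1-based index `i`
corresponds to the element of value `i - 1`) is 321-avoiding if there are no indices
`i < j < k` with `π k < π j < π i`. -/
def Avoids321 {m : ℕ} (π : Equiv.Perm (Fin m)) : Prop :=
  ∀ i j k : Fin m, i < j → j < k → ¬(π k < π j ∧ π j < π i)

/-- Monotone functions strictly above the diagonal on `[0,n)`, identity afterwards. -/
def TT (n : ℕ) : Set (ℕ → ℕ) :=
  {M | Monotone M ∧ (∀ i, i < n → i < M i) ∧ ∀ i, n ≤ i → M i = i}

/-- Monotone functions weakly above the diagonal, identity from `n - 1` on. -/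
def SS (n : ℕ) : Set (ℕ → ℕ) :=
  {f | Monotone f ∧ (∀ i, i ≤ f i) ∧ ∀ i, n ≤ i + 1 → f i = i}

def equivTS (n : ℕ) : TT n ≃ SS n where
  toFun M := ⟨fun i => if i < n then M.1 i - 1 else i, by
    obtain ⟨M, h1, h2, h3⟩ := M
    refine ⟨?_, ?_, ?_⟩
    · intro i j hij
      have := h1 hij
      have := h2 i
      have := h3 j
      dsimp only
      split_ifs <;> grind
    · intro i
      have := h2 i
      dsimp only
      split_ifs <;> grind
    · intro i hi
      have := h2 i
      have := h3 (i+1) hi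
      have := h1 (Nat.le_succ i)
      dsimp only
      split_ifs <;> grind⟩
  invFun f := ⟨fun i => if i < n then f.1 i + 1 else i, by
    obtain ⟨f, h1, h2, h3⟩ := f
    refine ⟨?_, ?_, ?_⟩
    · intro i j hij
      have := h1 hij
      have h4 : i < n → f i ≤ f (n - 1) := fun h => h1 (by omega)
      have := h3 (n - 1) (by omega)
      dsimp only
      split_ifs <;> grind
    · intro i hi
      have := h2 i
      dsimp only
      split_ifs; omega
    · intro i hi
      dsimp only
      split_ifs <;> grind⟩
  left_inv := by
    rintro ⟨M, h1, h2, h3⟩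
    ext i
    have := h2 i
    have := h3 i
    dsimp only
    split_ifs <;> grind
  right_inv := by
    rintro ⟨M, h1, h2, h3⟩
    ext i
    have := h2 i
    have := h3 i
    dsimp only
    split_ifs <;> grind

def glue (n : ℕ) (x : Σ i : Fin (n + 1), TT i × SS (n - i)) : SS (n + 1) :=
  ⟨fun j => if j ≤ x.1 then x.2.1.1 j else x.1 + 1 + x.2.2.1 (j - x.1 - 1), by
    obtain ⟨i, ⟨g, g1, g2, g3⟩, ⟨h, h1, h2, h3⟩⟩ := x
    refine ⟨?_, ?_, ?_⟩
    · intro a b hab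
      have e1 := g1 hab
      have e2 : a - i - 1 ≤ b - i - 1 := by omega
      have e3 := h1 e2
      have e4 : a ≤ i → g a ≤ g i := fun h => g1 h
      have e5 := g3 i le_rfl
      dsimp only
      split_ifs <;> grind
    · intro a
      have := g2 a
      have := g3 a
      have := h2 (a - i - 1)
      dsimp only
      split_ifs <;> grind
    · intro a ha
      have := g3 a
      have := h3 (a - i - 1)
      dsimp only
      split_ifs <;> grind⟩

lemma glue_inj (n : ℕ) : Function.Injective (glue n) := by
  rintro ⟨i, ⟨g, g1, g2, g3⟩, ⟨h, h1, h2, h3⟩⟩ ⟨i', ⟨g', g1', g2', g3'⟩, ⟨h', h1', h2', h3'⟩⟩ H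
  have H' : ∀ j, (if j ≤ (i : ℕ) then g j else i + 1 + h (j - i - 1)) =
      (if j ≤ (i' : ℕ) then g' j else i' + 1 + h' (j - i' - 1)) := by
    intro j
    exact congrFun (congrArg Subtype.val H) j
  have hi : i = i' := by
    rcases lt_trichotomy (i : ℕ) i' with hlt | heq | hlt
    · have := H' i
      have := g3 i le_rfl
      have := g2' i hlt
      grind
    · exact Fin.ext heq
    · have := H' i'
      have := g3' i' le_rfl
      have := g2 i' hlt
      grind
  subst hi
  have hg : g = g' := by
    funext j
    have := H' j
    have := g3 j
    have := g3' j
    grind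
  have hh : h = h' := by
    funext j
    have := H' (i + 1 + j)
    have e : (i : ℕ) + 1 + j - i - 1 = j := by omega
    rw [e] at this
    grind
  subst hg hh
  rfl

lemma glue_surj (n : ℕ) : Function.Surjective (glue n) := by
  rintro ⟨f, f1, f2, f3⟩
  have hex : ∃ i, f i = i := ⟨n, f3 n le_rfl⟩
  classical
  obtain ⟨i, hi, hmin⟩ : ∃ i, f i = i ∧ ∀ j < i, f j ≠ j :=
    ⟨Nat.find hex, Nat.find_spec hex, fun j hj => Nat.find_min hex hj⟩
  have hin : i ≤ n := by
    by_contra hc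
    exact hmin n (by omega) (f3 n le_rfl)
  refine ⟨⟨⟨i, by omega⟩, ⟨fun j => if j < i then f j else j, ?_, ?_, ?_⟩,
    ⟨fun j => f (i + 1 + j) - (i + 1), ?_, ?_, ?_⟩⟩, ?_⟩
  · intro a b hab
    have := f1 hab
    have : a ≤ i → f a ≤ f i := fun h => f1 h
    dsimp only
    split_ifs <;> grind
  · intro j hj
    have := f2 j
    have := hmin j hj
    dsimp only at hj ⊢
    split_ifs; omega
  · intro j hj
    dsimp only at hj ⊢
    split_ifs <;> grind
  · intro a b hab
    have : f (i + 1 + a) ≤ f (i + 1 + b) := f1 (by omega)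
    dsimp only
    omega
  · intro a
    have := f2 (i + 1 + a)
    dsimp only
    omega
  · intro a ha
    have := f3 (i + 1 + a) (by dsimp only at ha; omega)
    dsimp only
    omega
  · apply Subtype.ext
    funext j
    simp only [glue]
    have := f2 j
    split_ifs with h1 h2
    · rfl
    · have : j = i := by omega
      rw [this, hi]
    · have : i + 1 + (j - i - 1) = j := by omega
      rw [this]
      omega

lemma card_SS (n : ℕ) : Finite (SS n) ∧ Nat.card (SS n) = catalan n := by
  induction n using Nat.strong_induction_on with
  | _ n ih =>
  rcases n with _ | n
  · have : SS 0 = {id} := by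
      ext f
      constructor
      · rintro ⟨_, _, h⟩
        funext i
        exact h i (by omega)
      · rintro rfl
        exact ⟨monotone_id, fun i => le_rfl, fun i _ => rfl⟩
    rw [this]
    exact ⟨inferInstance, by simp⟩
  · have hS : ∀ i : Fin (n + 1), Finite (SS (n - i)) := fun i => (ih _ (by omega)).1
    have hT : ∀ i : Fin (n + 1), Finite (TT i) := fun i =>
      haveI := (ih i (by omega)).1
      Finite.of_equiv _ (equivTS i).symm
    let e := Equiv.ofBijective (glue n) ⟨glue_inj n, glue_surj n⟩
    refine ⟨Finite.of_equiv _ e, ?_⟩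
    rw [← Nat.card_congr e, Nat.card_sigma, catalan_succ]
    refine Finset.sum_congr rfl fun i _ => ?_
    rw [Nat.card_prod, Nat.card_congr (equivTS i), (ih i (by omega)).2, (ih (n - i) (by omega)).2]

lemma card_TT (n : ℕ) : Nat.card (TT n) = catalan n := by
  rw [Nat.card_congr (equivTS n), (card_SS n).2]

/-- extension of a permutation to naturals -/
def extP {m : ℕ} (π : Equiv.Perm (Fin m)) (i : ℕ) : ℕ := if h : i < m then π ⟨i, h⟩ else i

lemma extP_inj {m : ℕ} (π : Equiv.Perm (Fin m)) : Function.Injective (extP π) := by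
  intro a b h
  unfold extP at h
  split_ifs at h with h1 h2 h2
  · have := π.injective (Fin.ext h)
    simpa using this
  · have := (π ⟨a, h1⟩).2
    omega
  · have := (π ⟨b, h2⟩).2
    omega
  · exact h

lemma extP_val {m : ℕ} (π : Equiv.Perm (Fin m)) (i : Fin m) : extP π i = π i := by
  simp [extP]

/-- running maximum -/
def rmax (p : ℕ → ℕ) (i : ℕ) : ℕ := (Finset.range (i + 1)).sup p

lemma le_rmax (p : ℕ → ℕ) {i j : ℕ} (h : j ≤ i) : p j ≤ rmax p i :=
  Finset.le_sup (f := p) (by simp; omega)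

lemma rmax_attained (p : ℕ → ℕ) (i : ℕ) : ∃ j ≤ i, p j = rmax p i := by
  obtain ⟨j, hj, h⟩ := Finset.exists_mem_eq_sup (Finset.range (i + 1)) (by simp) p
  exact ⟨j, by simp at hj; omega, h.symm⟩

lemma rmax_mono (p : ℕ → ℕ) : Monotone (rmax p) := by
  intro a b h
  obtain ⟨j, hj, e⟩ := rmax_attained p a
  rw [← e]
  exact le_rmax p (by omega)

def Good (n : ℕ) (π : Equiv.Perm (Fin (n + 1))) : Prop := Avoids321 π ∧
        ∀ i : ℕ, 1 ≤ i → i ≤ n →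
          (fun x : Fin (n + 1) => π x) '' {x : Fin (n + 1) | (x : ℕ) < i} ≠
            {x : Fin (n + 1) | (x : ℕ) < i}

lemma rmax_mem {n : ℕ} {π : Equiv.Perm (Fin (n + 1))} (h : Good n π) :
    rmax (extP π) ∈ TT n := by
  refine ⟨rmax_mono _, ?_, ?_⟩
  · intro i hi
    by_contra hc
    apply h.2 (i + 1) (by omega) (by omega)
    have hsub : (fun x : Fin (n + 1) => π x) '' {x : Fin (n + 1) | (x : ℕ) < i + 1} ⊆
        {x : Fin (n + 1) | (x : ℕ) < i + 1} := by
      rintro _ ⟨x, hx, rfl⟩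
      have hx' : (x : ℕ) < i + 1 := hx
      have := le_rmax (extP π) (i := i) (j := x) (by omega)
      rw [extP_val] at this
      show (π x : ℕ) < i + 1
      omega
    refine Set.eq_of_subset_of_ncard_le hsub ?_ (Set.toFinite _)
    rw [Set.ncard_image_of_injective _ π.injective]
  · intro i hi
    apply le_antisymm
    · obtain ⟨j, hj, e⟩ := rmax_attained (extP π) i
      rw [← e]
      unfold extP
      split_ifs with hh
      · have := (π ⟨j, hh⟩).2
        omega
      · exact hj
    · by_cases hin : i = n
      · subst hin
        have := le_rmax (extP π) (i := i) (j := π.symm (Fin.last i)) (by omega)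
        rw [extP_val] at this
        simpa using this
      · have := le_rmax (extP π) (i := i) (j := i) le_rfl
        have e : extP π i = i := by
          unfold extP
          rw [dif_neg (by omega)]
        omega

/-- In a 321-avoiding permutation, a non-record value is the least value not used before. -/
lemma nonrecord {m : ℕ} {π : Equiv.Perm (Fin m)} (h : Avoids321 π) {i : ℕ}
    (hi : i < m) (hr : extP π i < rmax (extP π) i) (v : ℕ) (hv : v < extP π i) :
    ∃ j < i, extP π j = v := by
  have e : extP π i = π ⟨i, hi⟩ := extP_val π ⟨i, hi⟩
  have hvm : v < m := by
    have := (π ⟨i, hi⟩).2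
    omega
  set k := π.symm ⟨v, hvm⟩ with hk
  have hkv : π k = ⟨v, hvm⟩ := by simp [hk]
  have ek : extP π k = v := by rw [extP_val, hkv]
  by_contra hc
  push Not at hc
  have hki : i < k := by
    rcases lt_trichotomy i k with h1 | h1 | h1
    · exact h1
    · rw [← h1] at ek
      omega
    · exact absurd ek (hc k h1)
  obtain ⟨j, hj, ej⟩ := rmax_attained (extP π) i
  have hji : j < i := by
    rcases hj.lt_or_eq with h1 | h1
    · exact h1
    · rw [h1] at ej
      omega
  have ej' : extP π j = π ⟨j, by omega⟩ := extP_val π ⟨j, by omega⟩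
  refine h ⟨j, by omega⟩ ⟨i, hi⟩ k hji hki ⟨?_, ?_⟩
  · rw [Fin.lt_def, hkv]
    show v < _
    omega
  · rw [Fin.lt_def]
    omega

lemma rmax_succ (p : ℕ → ℕ) (i : ℕ) : rmax p (i + 1) = max (rmax p i) (p (i + 1)) := by
  unfold rmax
  rw [Finset.range_add_one (n := i + 1), Finset.sup_insert, max_comm]

lemma rmax_zero (p : ℕ → ℕ) : rmax p 0 = p 0 := by
  simp [rmax]

lemma record_eq (p q : ℕ → ℕ) (hpq : rmax p = rmax q) (hq : Function.Injective q)
    (i : ℕ) (ih : ∀ j < i, p j = q j) (hr : p i = rmax p i) (hp : Function.Injective p) :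
    q i = rmax q i := by
  rcases i with _ | i
  · rw [rmax_zero]
  · rw [rmax_succ]
    have h1 := rmax_succ q i
    have h2 := congrFun hpq (i + 1)
    have h3 := congrFun hpq i
    obtain ⟨j, hj, ej⟩ := rmax_attained p i
    have h4 : p j ≠ p (i + 1) := fun h => by
      have := hp h
      omega
    have := le_rmax p (i := i + 1) (j := j) (by omega)
    omega

lemma ext_inj {m : ℕ} {π σ : Equiv.Perm (Fin m)} (h1 : Avoids321 π) (h2 : Avoids321 σ)
    (h : rmax (extP π) = rmax (extP σ)) : π = σ := by
  have key : ∀ i, extP π i = extP σ i := by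
    intro i
    induction i using Nat.strong_induction_on with
    | _ i ih =>
    by_cases hi : i < m
    · by_cases hr : extP π i = rmax (extP π) i
      · rw [record_eq _ _ h (extP_inj σ) i ih hr (extP_inj π), hr, h]
      · have hr' : extP σ i ≠ rmax (extP σ) i := fun hc =>
          hr (record_eq _ _ h.symm (extP_inj π) i (fun j hj => (ih j hj).symm) hc (extP_inj σ))
        have l1 := lt_of_le_of_ne (le_rmax (extP π) le_rfl) hr
        have l2 := lt_of_le_of_ne (le_rmax (extP σ) le_rfl) hr'
        rcases lt_trichotomy (extP π i) (extP σ i) with hl | hl | hl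
        · obtain ⟨j, hj, e⟩ := nonrecord h2 hi l2 _ hl
          rw [← ih j hj] at e
          have := extP_inj π e
          omega
        · exact hl
        · obtain ⟨j, hj, e⟩ := nonrecord h1 hi l1 _ hl
          rw [ih j hj] at e
          have := extP_inj σ e
          omega
    · simp [extP, hi]
  ext i
  have := key i
  rwa [extP_val, extP_val] at this

open Classical in
/-- Reconstruct the permutation from its running maximum. -/
noncomputable def build (M : ℕ → ℕ) (i : ℕ) : ℕ :=
  if i = 0 ∨ M (i - 1) < M i then M i else sInf {v | ∀ j, (h : j < i) → build M j ≠ v}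
termination_by i

lemma mex_spec (p : ℕ → ℕ) (i : ℕ) :
    (∀ j < i, p j ≠ sInf {v | ∀ j, j < i → p j ≠ v}) ∧ sInf {v | ∀ j, j < i → p j ≠ v} ≤ i := by
  have hex : ∃ v ≤ i, ∀ j, j < i → p j ≠ v := by
    by_contra hc
    push Not at hc
    have hsub : Finset.range (i + 1) ⊆ (Finset.range i).image p := by
      intro v hv
      obtain ⟨j, hj, e⟩ := hc v (by simp at hv; omega)
      exact Finset.mem_image.2 ⟨j, by simpa using hj, e⟩
    have := (Finset.card_le_card hsub).trans Finset.card_image_le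
    simp at this
  obtain ⟨v, hv, h⟩ := hex
  exact ⟨Nat.sInf_mem (s := {v | ∀ j, j < i → p j ≠ v}) ⟨v, h⟩, (Nat.sInf_le (s := {v | ∀ j, j < i → p j ≠ v}) h).trans hv⟩

lemma build_rec (M : ℕ → ℕ) (i : ℕ) (h : i = 0 ∨ M (i - 1) < M i) : build M i = M i := by
  rw [build, if_pos h]

lemma build_non (M : ℕ → ℕ) (i : ℕ) (h : ¬ (i = 0 ∨ M (i - 1) < M i)) :
    build M i = sInf {v | ∀ j, j < i → build M j ≠ v} := by
  rw [build, if_neg h]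

lemma build_le (M : ℕ → ℕ) (hM : ∀ i, i ≤ M i) (i : ℕ) : build M i ≤ M i := by
  by_cases h : i = 0 ∨ M (i - 1) < M i
  · rw [build_rec M i h]
  · rw [build_non M i h]
    exact (mex_spec (build M) i).2.trans (hM i)

lemma build_ne (M : ℕ → ℕ) (hM : ∀ i, i ≤ M i) (hm : Monotone M) (i j : ℕ) (hj : j < i) :
    build M j ≠ build M i := by
  by_cases h : i = 0 ∨ M (i - 1) < M i
  · rw [build_rec M i h]
    have := build_le M hM j
    have : M j ≤ M (i - 1) := hm (by omega)
    omega
  · rw [build_non M i h]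
    exact (mex_spec (build M) i).1 j hj

lemma build_inj (M : ℕ → ℕ) (hM : ∀ i, i ≤ M i) (hm : Monotone M) :
    Function.Injective (build M) := by
  intro a b h
  rcases lt_trichotomy a b with hl | hl | hl
  · exact absurd h (build_ne M hM hm b a hl)
  · exact hl
  · exact absurd h.symm (build_ne M hM hm a b hl)

lemma build_attain (M : ℕ → ℕ) (hm : Monotone M) (i : ℕ) : ∃ j ≤ i, build M j = M i := by
  induction i with
  | zero => exact ⟨0, le_rfl, build_rec M 0 (Or.inl rfl)⟩
  | succ i ih =>
    by_cases h : M i < M (i + 1)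
    · exact ⟨i + 1, le_rfl, build_rec M _ (Or.inr h)⟩
    · obtain ⟨j, hj, e⟩ := ih
      have := hm (Nat.le_succ i)
      exact ⟨j, by omega, by rw [e]; simp only [Nat.succ_eq_add_one] at this; omega⟩

lemma build_rmax (M : ℕ → ℕ) (hM : ∀ i, i ≤ M i) (hm : Monotone M) : rmax (build M) = M := by
  funext i
  apply le_antisymm
  · obtain ⟨j, hj, e⟩ := rmax_attained (build M) i
    rw [← e]
    exact (build_le M hM j).trans (hm hj)
  · obtain ⟨j, hj, e⟩ := build_attain M hm i
    rw [← e]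
    exact le_rmax _ hj

lemma build_avoid (M : ℕ → ℕ) (hM : ∀ i, i ≤ M i) (hm : Monotone M) (i j k : ℕ)
    (hij : i < j) (hjk : j < k) (h1 : build M k < build M j) (h2 : build M j < build M i) :
    False := by
  by_cases h : j = 0 ∨ M (j - 1) < M j
  · rw [build_rec M j h] at h2
    have := build_le M hM i
    have := hm hij.le
    omega
  · have e := build_non M j h
    rw [e] at h1
    have := Nat.notMem_of_lt_sInf h1
    simp only [Set.mem_ofPred_eq, not_forall, not_not] at this
    obtain ⟨l, hl, hh⟩ := this
    have := build_inj M hM hm hh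
    omega

lemma surj_aux (n : ℕ) (M : ℕ → ℕ) (h : M ∈ TT n) :
    ∃ π : Equiv.Perm (Fin (n + 1)), Good n π ∧ rmax (extP π) = M := by
  obtain ⟨hm, h2, h3⟩ := h
  have hM : ∀ i, i ≤ M i := by
    intro i
    by_cases hi : i < n
    · exact (h2 i hi).le
    · exact (h3 i (by omega)).ge
  have hb : ∀ i : Fin (n + 1), build M i < n + 1 := by
    intro i
    have a1 := build_le M hM i
    have a2 : M i ≤ M n := hm (by omega)
    have a3 := h3 n le_rfl
    omega
  let f : Fin (n + 1) → Fin (n + 1) := fun i => ⟨build M i, hb i⟩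
  have hf : Function.Injective f := by
    intro a b hab
    exact Fin.ext (build_inj M hM hm (congrArg Fin.val hab))
  let π : Equiv.Perm (Fin (n + 1)) := Equiv.ofBijective f (Finite.injective_iff_bijective.1 hf)
  have hπ : ∀ x, (π x : ℕ) = build M x := fun x => rfl
  have hext : ∀ i, i ≤ n → extP π i = build M i := by
    intro i hi
    rw [← hπ ⟨i, by omega⟩, ← extP_val]
  refine ⟨π, ⟨?_, ?_⟩, ?_⟩
  · rintro i j k hij hjk ⟨u1, u2⟩
    exact build_avoid M hM hm i j k hij hjk u1 u2
  · intro i hi hin hc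
    obtain ⟨j, hj, e⟩ := build_attain M hm (i - 1)
    have hj' : j < n + 1 := by omega
    have : π ⟨j, hj'⟩ ∈ {x : Fin (n + 1) | (x : ℕ) < i} := by
      rw [← hc]
      exact ⟨⟨j, hj'⟩, by show j < i; omega, rfl⟩
    have t : (π ⟨j, hj'⟩ : ℕ) < i := this
    rw [hπ] at t
    have := h2 (i - 1) (by omega)
    dsimp only at t
    omega
  · funext i
    by_cases hi : i ≤ n
    · rw [← congrFun (build_rmax M hM hm) i]
      unfold rmax
      refine Finset.sup_congr rfl fun j hj => hext j ?_
      simp at hj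
      omega
    · rw [h3 i (by omega)]
      apply le_antisymm
      · obtain ⟨j, hj, e⟩ := rmax_attained (extP π) i
        rw [← e]
        unfold extP
        split_ifs with hh
        · have := (π ⟨j, hh⟩).2
          omega
        · exact hj
      · have := le_rmax (extP π) (i := i) (j := i) le_rfl
        have e : extP π i = i := by
          unfold extP
          rw [dif_neg (by omega)]
        omega

/-- For every `n ≥ 0`, the number of 321-avoiding permutations `π` of `{1,…,n+1}` such that
for every index `i` with `1 ≤ i ≤ n` the permutation `π` does NOT map the 1-based initial
segment `{1,…,i}` (i.e. `{x : Fin (n+1) | (x : ℕ) < i}`) onto itself equals the `n`-th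
Catalan number. -/
theorem stmt10 (n : ℕ) :
    Nat.card {π : Equiv.Perm (Fin (n + 1)) // Avoids321 π ∧
        ∀ i : ℕ, 1 ≤ i → i ≤ n →
          (fun x : Fin (n + 1) => π x) '' {x : Fin (n + 1) | (x : ℕ) < i} ≠
            {x : Fin (n + 1) | (x : ℕ) < i}} = catalan n := by
  rw [← card_TT]
  let F : {π : Equiv.Perm (Fin (n + 1)) // Good n π} → TT n :=
    fun π => ⟨rmax (extP π.1), rmax_mem π.2⟩
  refine Nat.card_congr (Equiv.ofBijective F ⟨?_, ?_⟩)
  · rintro ⟨π, hπ⟩ ⟨σ, hσ⟩ h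
    exact Subtype.ext (ext_inj hπ.1 hσ.1 (congrArg Subtype.val h))
  · rintro ⟨M, hM⟩
    obtain ⟨π, hπ, e⟩ := surj_aux n M hM
    exact ⟨⟨π, hπ⟩, Subtype.ext e⟩
end
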